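/- Let g(y) = y(1+y²)², fix y₀ > 0, and let (y_n)_{n≥0} be the backward orbit determined by g(y_n) = y_{n−1} for n ≥ 1 (which exists and is unique since g is an increasing bijection of [0,∞)). Then there exist constants D₁, D₂ > 0 such that for all n ≥ 1, D₁·n^{7/4} ≤ ∏_{i=1}^{n} (1+y_i²)²(1+5y_i²) ≤ D₂·n^{7/4}. -/

import Mathlib

section BackwardOrbit

variable {y : ℕ → ℝ}

lemma backwardOrbit_pos (h0 : 0 < y 0)
    (hyb : ∀ n : ℕ, y (n + 1) * (1 + y (n + 1) ^ 2) ^ 2 = y n) (n : ℕ) : 0 < y n := by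
  induction n with
  | zero => exact h0
  | succ n ih =>
    rw [← hyb n] at ih
    exact pos_of_mul_pos_left ih (by positivity)

lemma backwardOrbit_sq
    (hyb : ∀ n : ℕ, y (n + 1) * (1 + y (n + 1) ^ 2) ^ 2 = y n) (n : ℕ) :
    y n ^ 2 = y (n + 1) ^ 2 * (1 + y (n + 1) ^ 2) ^ 4 := by
  rw [← hyb n]; ring

lemma backwardOrbit_antitone (h0 : 0 < y 0)
    (hyb : ∀ n : ℕ, y (n + 1) * (1 + y (n + 1) ^ 2) ^ 2 = y n) : Antitone y := by
  refine antitone_nat_of_succ_le fun n => ?_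
  have h := backwardOrbit_pos h0 hyb (n + 1)
  rw [← hyb n]
  exact le_mul_of_one_le_right h.le (one_le_pow₀ (by nlinarith))

lemma inv_step_bounds {a : ℝ} (ha : 0 < a) :
    4 / (1 + a) ^ 4 ≤ a⁻¹ - (a * (1 + a) ^ 4)⁻¹ ∧ a⁻¹ - (a * (1 + a) ^ 4)⁻¹ ≤ 4 := by
  have h : a⁻¹ - (a * (1 + a) ^ 4)⁻¹ = (4 + 6 * a + 4 * a ^ 2 + a ^ 3) / (1 + a) ^ 4 := by
    field_simp
    ring
  rw [h]
  constructor
  · gcongr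
    nlinarith [pow_pos ha 2, pow_pos ha 3]
  · rw [div_le_iff₀ (by positivity)]
    nlinarith [pow_pos ha 2, pow_pos ha 3, pow_pos ha 4]

lemma backwardOrbit_inv_sq_le (h0 : 0 < y 0)
    (hyb : ∀ n : ℕ, y (n + 1) * (1 + y (n + 1) ^ 2) ^ 2 = y n) (n : ℕ) :
    (y n ^ 2)⁻¹ ≤ (y 0 ^ 2)⁻¹ + 4 * n := by
  induction n with
  | zero => simp
  | succ n ih =>
    have h := (inv_step_bounds (pow_pos (backwardOrbit_pos h0 hyb (n + 1)) 2)).2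
    rw [← backwardOrbit_sq hyb n] at h
    push_cast
    linarith

lemma le_backwardOrbit_inv_sq (h0 : 0 < y 0)
    (hyb : ∀ n : ℕ, y (n + 1) * (1 + y (n + 1) ^ 2) ^ 2 = y n) (n : ℕ) :
    4 / (1 + y 0 ^ 2) ^ 4 * n ≤ (y n ^ 2)⁻¹ := by
  induction n with
  | zero => simp only [Nat.cast_zero, mul_zero]; positivity
  | succ n ih =>
    have hp := backwardOrbit_pos h0 hyb (n + 1)
    have h := (inv_step_bounds (pow_pos hp 2)).1
    rw [← backwardOrbit_sq hyb n] at h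
    have hle : y (n + 1) ≤ y 0 := backwardOrbit_antitone h0 hyb (Nat.zero_le _)
    have h' : 4 / (1 + y 0 ^ 2) ^ 4 ≤ 4 / (1 + y (n + 1) ^ 2) ^ 4 := by gcongr
    push_cast
    linarith

lemma one_add_pow_five_le {a : ℝ} (ha : 0 ≤ a) :
    (1 + a) ^ 5 ≤ (1 + 5 * a) * Real.exp (5 / 2 * (a * (1 + a) ^ 4 - a)) := by
  calc (1 + a) ^ 5 ≤ (1 + 5 * a) * (5 / 2 * (a * (1 + a) ^ 4 - a) + 1) := by
        have : 0 ≤ 55 * a ^ 3 + 80 * a ^ 4 + (103 / 2) * a ^ 5 + 25 / 2 * a ^ 6 := by positivity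
        nlinarith
    _ ≤ _ := by gcongr; exact Real.add_one_le_exp _

lemma sq_distortion_mul_pow_le (h0 : 0 < y 0)
    (hyb : ∀ n : ℕ, y (n + 1) * (1 + y (n + 1) ^ 2) ^ 2 = y n) (n : ℕ) :
    (∏ i ∈ Finset.Icc 1 n, (1 + y i ^ 2) ^ 2 * (1 + 5 * y i ^ 2)) ^ 2 * y n ^ 7 ≤ y 0 ^ 7 := by
  induction n with
  | zero => simp
  | succ n ih =>
    refine le_trans ?_ ih
    rw [Finset.prod_Icc_succ_top (by omega)]
    have hp := backwardOrbit_pos h0 hyb (n + 1)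
    rw [← hyb n]
    set P := ∏ i ∈ Finset.Icc 1 n, (1 + y i ^ 2) ^ 2 * (1 + 5 * y i ^ 2)
    set z := y (n + 1)
    have h5 : 1 + 5 * z ^ 2 ≤ (1 + z ^ 2) ^ 5 := by
      have := one_add_mul_le_pow (a := z ^ 2) (by nlinarith) 5
      norm_num at this
      linarith
    calc _ = P ^ 2 * z ^ 7 * (1 + z ^ 2) ^ 4 * (1 + 5 * z ^ 2) ^ 2 := by ring
      _ ≤ P ^ 2 * z ^ 7 * (1 + z ^ 2) ^ 4 * ((1 + z ^ 2) ^ 5) ^ 2 := by gcongr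
      _ = _ := by ring

lemma le_sq_distortion_mul_pow (h0 : 0 < y 0)
    (hyb : ∀ n : ℕ, y (n + 1) * (1 + y (n + 1) ^ 2) ^ 2 = y n) (n : ℕ) :
    y 0 ^ 7 ≤ (∏ i ∈ Finset.Icc 1 n, (1 + y i ^ 2) ^ 2 * (1 + 5 * y i ^ 2)) ^ 2 * y n ^ 7 *
      Real.exp (5 / 2 * (y 0 ^ 2 - y n ^ 2)) ^ 2 := by
  induction n with
  | zero => simp
  | succ n ih =>
    refine ih.trans ?_
    rw [Finset.prod_Icc_succ_top (by omega)]
    have hp := backwardOrbit_pos h0 hyb (n + 1)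
    have hsq := backwardOrbit_sq hyb n
    have h5 := one_add_pow_five_le (sq_nonneg (y (n + 1)))
    rw [← hsq] at h5
    have hexp : Real.exp (5 / 2 * (y 0 ^ 2 - y (n + 1) ^ 2)) =
        Real.exp (5 / 2 * (y 0 ^ 2 - y n ^ 2)) *
          Real.exp (5 / 2 * (y n ^ 2 - y (n + 1) ^ 2)) := by
      rw [← Real.exp_add]; ring_nf
    rw [hexp]
    set E := Real.exp (5 / 2 * (y 0 ^ 2 - y n ^ 2))
    set F := Real.exp (5 / 2 * (y n ^ 2 - y (n + 1) ^ 2))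
    rw [← hyb n]
    set P := ∏ i ∈ Finset.Icc 1 n, (1 + y i ^ 2) ^ 2 * (1 + 5 * y i ^ 2)
    set z := y (n + 1)
    calc _ = P ^ 2 * z ^ 7 * E ^ 2 * (1 + z ^ 2) ^ 4 * ((1 + z ^ 2) ^ 5) ^ 2 := by ring
      _ ≤ P ^ 2 * z ^ 7 * E ^ 2 * (1 + z ^ 2) ^ 4 * ((1 + 5 * z ^ 2) * F) ^ 2 := by gcongr
      _ = _ := by ring

end BackwardOrbit

lemma mul_rpow_seven_quarters_pow_four {c x : ℝ} (hx : 0 ≤ x) :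
    (c * x ^ ((7 : ℝ) / 4)) ^ 4 = c ^ 4 * x ^ 7 := by
  rw [mul_pow, ← Real.rpow_mul_natCast hx, ← Real.rpow_natCast x 7]
  norm_num

/-- Example 1 of Hu–Vaienti, estimate along the invariant `y`-axis: for the
backward orbit of `y₀ > 0` under `g(y) = y(1+y²)²`, the distortion products
`∏_{i=1}^n (1+y_i²)²(1+5y_i²) = |det DT^{-n}(0,y₀)|⁻¹` grow like `n^{7/4}`. -/
theorem stmt_17 (y₀ : ℝ) (hy₀ : 0 < y₀) (y : ℕ → ℝ) (hy0 : y 0 = y₀)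
    (hyb : ∀ n : ℕ, y (n + 1) * (1 + y (n + 1) ^ 2) ^ 2 = y n) :
    ∃ D₁ D₂ : ℝ, 0 < D₁ ∧ 0 < D₂ ∧ ∀ n : ℕ, 1 ≤ n →
      D₁ * (n : ℝ) ^ ((7 : ℝ) / 4) ≤
          ∏ i ∈ Finset.Icc 1 n, (1 + y i ^ 2) ^ 2 * (1 + 5 * y i ^ 2) ∧
        ∏ i ∈ Finset.Icc 1 n, (1 + y i ^ 2) ^ 2 * (1 + 5 * y i ^ 2) ≤
          D₂ * (n : ℝ) ^ ((7 : ℝ) / 4) := by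
  subst hy0
  set m : ℝ := 4 / (1 + y 0 ^ 2) ^ 4 with hm
  set M : ℝ := (y 0 ^ 2)⁻¹ + 4 with hM
  set A : ℝ := y 0 ^ 7 / Real.exp (5 / 2 * y 0 ^ 2) ^ 2 with hA
  have hmpos : 0 < m := by positivity
  have hMpos : 0 < M := by positivity
  have hApos : 0 < A := by positivity
  have root : ∀ c : ℝ, 0 < c → (c ^ ((4 : ℝ)⁻¹)) ^ 4 = c := fun c hc => by
    simpa using Real.rpow_inv_natCast_pow hc.le (n := 4) (by norm_num)
  refine ⟨(A ^ 2 * m ^ 7) ^ ((4 : ℝ)⁻¹), ((y 0 ^ 7) ^ 2 * M ^ 7) ^ ((4 : ℝ)⁻¹),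
    by positivity, by positivity, fun n hn => ?_⟩
  have hn' : (1 : ℝ) ≤ n := by exact_mod_cast hn
  have hp := backwardOrbit_pos hy₀ hyb n
  have hlow := le_backwardOrbit_inv_sq hy₀ hyb n
  have hupp : (y n ^ 2)⁻¹ ≤ M * n := by
    refine (backwardOrbit_inv_sq_le hy₀ hyb n).trans ?_
    have : 0 < (y 0 ^ 2)⁻¹ := by positivity
    rw [hM]; nlinarith
  have hPu := sq_distortion_mul_pow_le hy₀ hyb n
  have hPl := le_sq_distortion_mul_pow hy₀ hyb n
  have hPpos : 0 < ∏ i ∈ Finset.Icc 1 n, (1 + y i ^ 2) ^ 2 * (1 + 5 * y i ^ 2) :=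
    Finset.prod_pos fun i _ => by positivity
  set P := ∏ i ∈ Finset.Icc 1 n, (1 + y i ^ 2) ^ 2 * (1 + 5 * y i ^ 2)
  have hPl' : A ≤ P ^ 2 * y n ^ 7 := by
    rw [hA, div_le_iff₀ (by positivity)]
    refine hPl.trans ?_
    gcongr
    nlinarith
  have hP4 : P ^ 4 = (P ^ 2 * y n ^ 7) ^ 2 * ((y n ^ 2)⁻¹) ^ 7 := by
    field_simp
  constructor
  · refine le_of_pow_le_pow_left₀ four_ne_zero hPpos.le ?_
    rw [mul_rpow_seven_quarters_pow_four (by positivity), root _ (by positivity), hP4,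
      mul_assoc, ← mul_pow]
    gcongr
  · refine le_of_pow_le_pow_left₀ four_ne_zero (by positivity) ?_
    rw [mul_rpow_seven_quarters_pow_four (by positivity), root _ (by positivity), hP4,
      mul_assoc, ← mul_pow M]
    gcongr
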